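/- Let n ≥ 1, let K be a subset of ℝⁿ that is locally connected in its subspace topology and nowhere flat in ℝⁿ, and let A ⊆ K be an analytic set that is non-meager in the subspace K. Then the n-fold Minkowski sum (A − A)^{+n} of the difference set A − A is a neighborhood of zero in ℝⁿ (i.e., 0 lies in its interior). -/

import Mathlib

open Pointwise

/-- The `n`-fold Minkowski sum `T + ⋯ + T` of a set `T`. -/
def nFoldSum {X : Type*} [AddCommMonoid X] (T : Set X) (n : ℕ) : Set X :=
  {x | ∃ f : Fin n → X, (∀ i, f i ∈ T) ∧ ∑ i, f i = x}

/-- A set `K ⊆ ℝⁿ` is nowhere flat if every nonempty relatively open subset of `K`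
has affine span equal to all of `ℝⁿ`. -/
def NowhereFlat {n : ℕ} (K : Set (Fin n → ℝ)) : Prop :=
  ∀ V : Set (Fin n → ℝ), IsOpen V → (V ∩ K).Nonempty → affineSpan ℝ (V ∩ K) = ⊤

open MeasureTheory Set Filter Topology

/-- The integral of the exponential along a complex segment. -/
lemma mul_integral_exp_segment (u v : ℂ) :
    v * ∫ t in (0 : ℝ)..1, Complex.exp (u + t * v) = Complex.exp (u + v) - Complex.exp u := by
  by_cases hv : v = 0
  · simp [hv]
  · have : (fun t : ℝ => Complex.exp (u + t * v)) =
        fun t : ℝ => Complex.exp u * Complex.exp (v * t) := by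
      funext t
      rw [← Complex.exp_add, mul_comm v]
    rw [this, intervalIntegral.integral_const_mul, integral_exp_mul_complex hv]
    rw [Complex.exp_add]
    field_simp
    simp

/-- The projection of `ℝᵈ` onto the torus. -/
def toTorus {d : Type*} (y : d → ℝ) : UnitAddTorus d := fun i => (y i : UnitAddCircle)

lemma continuous_toTorus {d : Type*} : Continuous (toTorus : (d → ℝ) → UnitAddTorus d) :=
  continuous_pi fun i => (AddCircle.continuous_mk' 1).comp (continuous_apply i)

lemma dist_toTorus_le {d : Type*} [Fintype d] (x y : d → ℝ) :
    dist (toTorus x) (toTorus y) ≤ dist x y := by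
  refine (dist_pi_le_iff dist_nonneg).2 fun i => le_trans ?_ (dist_le_pi_dist x y i)
  rw [dist_eq_norm, dist_eq_norm]
  exact QuotientAddGroup.norm_mk_le_norm (S := AddSubgroup.zmultiples (1 : ℝ)) (m := x i - y i)

lemma mFourier_toTorus {d : Type*} [Fintype d] (k : d → ℤ) (y : d → ℝ) :
    UnitAddTorus.mFourier k (toTorus y) =
      Complex.exp (2 * Real.pi * Complex.I * ∑ a, (k a : ℂ) * y a) := by
  simp only [UnitAddTorus.mFourier, toTorus, ContinuousMap.coe_mk, fourier_coe_apply,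
    ← Complex.exp_sum, Finset.mul_sum]
  congr 1
  refine Finset.sum_congr rfl fun a _ => ?_
  push_cast
  ring

/-- The normalised Haar measure on the torus. -/
noncomputable def torusHaar (d : Type*) [Fintype d] : Measure (UnitAddTorus d) :=
  Measure.pi fun _ => (AddCircle.haarAddCircle : Measure UnitAddCircle)

instance {d : Type*} [Fintype d] : IsProbabilityMeasure (torusHaar d) := by
  unfold torusHaar; infer_instance

instance {d : Type*} [Fintype d] : (torusHaar d).IsOpenPosMeasure := by
  unfold torusHaar; infer_instance

lemma integral_mFourier {d : Type*} [Fintype d] (k : d → ℤ) :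
    ∫ x, UnitAddTorus.mFourier k x ∂(torusHaar d) = if k = 0 then 1 else 0 := by
  have h1 (m : ℤ) : ∫ x : UnitAddCircle, fourier m x ∂AddCircle.haarAddCircle =
      if m = 0 then 1 else 0 := by
    have := congrFun (fourierCoeff_fourier (T := 1) m) 0
    simp only [fourierCoeff, neg_zero, fourier_zero, one_smul] at this
    rw [this, Pi.single_apply]
    simp [eq_comm]
  unfold torusHaar
  simp only [UnitAddTorus.mFourier, ContinuousMap.coe_mk]
  rw [integral_fintype_prod_eq_prod (fun i (x : UnitAddCircle) => (fourier (k i) x : ℂ))]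
  simp only [h1, Finset.prod_ite_zero, Finset.prod_const_one]
  simp [funext_iff]

/-- Integration of `φ ∘ g` as a continuous linear functional of `φ`. -/
noncomputable def integralCompCLM {T Y : Type*} [TopologicalSpace T] [CompactSpace T]
    [TopologicalSpace Y] [MeasurableSpace Y] [BorelSpace Y]
    (μ : Measure Y) [IsFiniteMeasure μ] (g : C(Y, T)) : C(T, ℂ) →L[ℂ] ℂ :=
  have hint (φ : C(T, ℂ)) : Integrable (fun y => φ (g y)) μ :=
    Integrable.of_bound (φ.continuous.comp g.continuous).aestronglyMeasurable ‖φ‖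
      (ae_of_all _ fun y => φ.norm_coe_le_norm (g y))
  LinearMap.mkContinuous
    { toFun := fun φ => ∫ y, φ (g y) ∂μ
      map_add' := fun φ ψ => integral_add (hint φ) (hint ψ)
      map_smul' := fun c φ => integral_const_mul c fun y => φ (g y) }
    (μ.real univ) fun φ => by
      rw [mul_comm]
      exact norm_integral_le_of_norm_le_const (ae_of_all _ fun y => φ.norm_coe_le_norm (g y))

@[simp] lemma integralCompCLM_apply {T Y : Type*} [TopologicalSpace T] [CompactSpace T]
    [TopologicalSpace Y] [MeasurableSpace Y] [BorelSpace Y]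
    (μ : Measure Y) [IsFiniteMeasure μ] (g : C(Y, T)) (φ : C(T, ℂ)) :
    integralCompCLM μ g φ = ∫ y, φ (g y) ∂μ := rfl

/-- Change of variables for sums of polygonal paths: if the `i`-th polygonal path goes
from `p i 0` to `p i 0 + eᵢ`, then the sum of the paths parametrises the torus with degree one. -/
lemma integral_torus_eq_sum_polygonal {n : ℕ} (m : Fin n → ℕ) (p : Fin n → ℕ → Fin n → ℝ)
    (hp : ∀ i, p i (m i) = p i 0 + Pi.single i 1) (φ : C(UnitAddTorus (Fin n), ℂ)) :
    ∫ x, φ x ∂(torusHaar (Fin n)) =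
      ∑ r ∈ Fintype.piFinset fun i => Finset.range (m i),
        Matrix.det (fun i a => ((p i (r i + 1) a - p i (r i) a : ℝ) : ℂ)) *
          ∫ t : Fin n → ℝ, φ (toTorus (∑ i, (p i (r i) + t i • (p i (r i + 1) - p i (r i)))))
            ∂(Measure.pi fun _ => (volume.restrict (Ioc (0 : ℝ) 1))) := by
  let g (r : Fin n → ℕ) : C(Fin n → ℝ, UnitAddTorus (Fin n)) :=
    ⟨fun t => toTorus (∑ i, (p i (r i) + t i • (p i (r i + 1) - p i (r i)))),
      continuous_toTorus.comp (by fun_prop)⟩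
  let D (r : Fin n → ℕ) : ℂ := Matrix.det (fun i a => ((p i (r i + 1) a - p i (r i) a : ℝ) : ℂ))
  let μ : Measure (Fin n → ℝ) := Measure.pi fun _ => (volume.restrict (Ioc (0 : ℝ) 1))
  have key : integralCompCLM (torusHaar (Fin n)) (ContinuousMap.id _) =
      ∑ r ∈ Fintype.piFinset fun i => Finset.range (m i), D r • integralCompCLM μ (g r) := by
    refine ContinuousLinearMap.ext_on
      (s := Set.range (UnitAddTorus.mFourier (d := Fin n))) ?_ ?_
    · rw [dense_iff_closure_eq, ← Submodule.topologicalClosure_coe,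
        UnitAddTorus.span_mFourier_closure_eq_top]
      rfl
    · rintro _ ⟨k, rfl⟩
      simp only [sum_apply, smul_apply,
        integralCompCLM_apply, ContinuousMap.id_apply, integral_mFourier]
      let E (y : Fin n → ℝ) : ℂ := Complex.exp (2 * Real.pi * Complex.I * ∑ a, (k a : ℂ) * y a)
      let J (i : Fin n) (j : ℕ) : ℂ :=
        ∫ t in (0 : ℝ)..1, E (p i j + t • (p i (j + 1) - p i j))
      have hJ (i : Fin n) (j : ℕ) :
          (2 * Real.pi * Complex.I * ∑ a, (k a : ℂ) * (p i (j + 1) a - p i j a : ℝ)) * J i j =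
            E (p i (j + 1)) - E (p i j) := by
        have := mul_integral_exp_segment
          (2 * Real.pi * Complex.I * ∑ a, (k a : ℂ) * p i j a)
          (2 * Real.pi * Complex.I * ∑ a, (k a : ℂ) * (p i (j + 1) a - p i j a : ℝ))
        convert this using 2
        · refine intervalIntegral.integral_congr fun t _ => ?_
          simp only [E]
          congr 1
          rw [mul_left_comm, ← mul_add, Finset.mul_sum (a := (t : ℂ)), ← Finset.sum_add_distrib]
          congr 1
          refine Finset.sum_congr rfl fun a _ => ?_
          simp
          ring
        · simp only [E]
          congr 1
          rw [← mul_add, ← Finset.sum_add_distrib]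
          congr 1
          refine Finset.sum_congr rfl fun a _ => ?_
          push_cast
          ring
      have hint (r : Fin n → ℕ) : ∫ t, UnitAddTorus.mFourier k (g r t) ∂μ = ∏ i, J i (r i) := by
        have : ∀ t : Fin n → ℝ, UnitAddTorus.mFourier k (g r t) =
            ∏ i, E (p i (r i) + t i • (p i (r i + 1) - p i (r i))) := by
          intro t
          simp only [g, ContinuousMap.coe_mk, mFourier_toTorus, E, ← Complex.exp_sum,
            ← Finset.mul_sum]
          rw [Finset.sum_comm]
          simp [Finset.mul_sum]
        simp only [this, μ]
        rw [integral_fintype_prod_eq_prod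
          (fun i (s : ℝ) => E (p i (r i) + s • (p i (r i + 1) - p i (r i))))]
        refine Finset.prod_congr rfl fun i _ => ?_
        simp only [J]
        rw [intervalIntegral.integral_of_le zero_le_one]
      let W : Matrix (Fin n) (Fin n) ℂ := Matrix.of fun i => ∑ j ∈ Finset.range (m i),
        J i j • fun a => ((p i (j + 1) a - p i j a : ℝ) : ℂ)
      have hdet : ∑ r ∈ Fintype.piFinset fun i => Finset.range (m i), D r * ∏ i, J i (r i) =
          Matrix.det W := by
        have := (Matrix.detRowAlternating (n := Fin n) (R := ℂ)).toMultilinearMap.map_sum_finset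
          (fun i j => J i j • fun a => ((p i (j + 1) a - p i j a : ℝ) : ℂ))
          (fun i => Finset.range (m i))
        refine Eq.trans (Finset.sum_congr rfl fun r _ => ?_) this.symm
        rw [MultilinearMap.map_smul_univ, smul_eq_mul, mul_comm]
        rfl
      simp only [hint, smul_eq_mul, hdet]
      split_ifs with hk
      · have hJ1 : ∀ i j, J i j = 1 := by simp [J, E, hk]
        have : W = (1 : Matrix (Fin n) (Fin n) ℂ) := by
          funext i a
          simp only [W, hJ1, one_smul, Matrix.of_apply, Finset.sum_apply]
          rw [← Complex.ofReal_sum, Finset.sum_range_sub (fun j => p i j a), hp]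
          by_cases h : i = a <;> simp [Matrix.one_apply, h, eq_comm]
        rw [this, Matrix.det_one]
      · symm
        rw [← Matrix.exists_mulVec_eq_zero_iff]
        refine ⟨fun a => (k a : ℂ), fun h => hk ?_, ?_⟩
        · funext a
          simpa using congrFun h a
        · funext i
          have h2 : (2 * Real.pi * Complex.I : ℂ) ≠ 0 := Complex.two_pi_I_ne_zero
          refine (mul_eq_zero.1 ?_).resolve_left h2
          calc (2 * Real.pi * Complex.I : ℂ) * Matrix.mulVec W (fun a => (k a : ℂ)) i
              = ∑ j ∈ Finset.range (m i), (2 * Real.pi * Complex.I *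
                  ∑ a, (k a : ℂ) * (p i (j + 1) a - p i j a : ℝ)) * J i j := by
                simp only [Matrix.mulVec, dotProduct, W, Matrix.of_apply, Finset.sum_apply, Finset.sum_mul,
                  Finset.mul_sum, Pi.smul_apply, smul_eq_mul]
                rw [Finset.sum_comm]
                refine Finset.sum_congr rfl fun j _ => Finset.sum_congr rfl fun a _ => ?_
                ring
            _ = E (p i (m i)) - E (p i 0) := by
                simp only [hJ]
                exact Finset.sum_range_sub (fun j => E (p i j)) (m i)
            _ = 0 := by
                rw [sub_eq_zero, hp]
                simp only [E]
                have : ∑ a, (k a : ℂ) * ((p i 0 + Pi.single i 1 : Fin n → ℝ) a : ℝ) =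
                    ∑ a, (k a : ℂ) * (p i 0 a : ℝ) + k i := by
                  simp only [Pi.add_apply, Complex.ofReal_add, mul_add, Finset.sum_add_distrib]
                  congr 1
                  rw [Finset.sum_eq_single i] <;> simp +contextual
                rw [this, mul_add, Complex.exp_add, mul_comm _ (k i : ℂ),
                  Complex.exp_int_mul_two_pi_mul_I, mul_one]
  simpa [g, D, μ] using DFunLike.congr_fun key φ

/-- Two points of a preconnected set can be joined by an `ε`-chain inside the set. -/
lemma IsPreconnected.exists_chain {α : Type*} [PseudoMetricSpace α] {C : Set α}
    (hC : IsPreconnected C) {x y : α} (hx : x ∈ C) (hy : y ∈ C) {ε : ℝ} (hε : 0 < ε) :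
    ∃ (m : ℕ) (p : ℕ → α), p 0 = x ∧ p m = y ∧ (∀ j, p j ∈ C) ∧
      ∀ j, dist (p j) (p (j + 1)) < ε := by
  have h : Relation.ReflTransGen (fun u v => u ∈ C ∧ dist u v < ε) x y := by
    refine hC.induction₂' _ (fun u hu => ?_) (fun _ _ _ _ _ _ => Relation.ReflTransGen.trans) hx hy
    filter_upwards [self_mem_nhdsWithin, mem_nhdsWithin_of_mem_nhds (Metric.ball_mem_nhds u hε)]
      with v hv hv'
    exact ⟨.single ⟨hu, by rwa [dist_comm]⟩, .single ⟨hv, hv'⟩⟩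
  clear hx
  induction h using Relation.ReflTransGen.head_induction_on with
  | refl => exact ⟨0, fun _ => y, rfl, rfl, fun _ => hy, fun _ => by simpa using hε⟩
  | @head u v huv _ ih =>
    obtain ⟨m, p, h0, hm, hp, hd⟩ := ih
    refine ⟨m + 1, fun j => Nat.casesOn j u p, rfl, hm, ?_, ?_⟩
    · rintro (_ | j)
      exacts [huv.1, hp j]
    · rintro (_ | j)
      · simpa [h0] using huv.2
      · exact hd j

/-- If each preconnected set `C i` contains two points differing by the `i`-th basis vector, then
the sum of the sets `C i` is dense in the torus. -/
lemma exists_dist_toTorus_sum_lt {n : ℕ} (C : Fin n → Set (Fin n → ℝ))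
    (hC : ∀ i, IsPreconnected (C i)) (a : Fin n → Fin n → ℝ) (ha : ∀ i, a i ∈ C i)
    (ha' : ∀ i, a i + Pi.single i 1 ∈ C i) (x : Fin n → ℝ) {δ : ℝ} (hδ : 0 < δ) :
    ∃ c : Fin n → Fin n → ℝ, (∀ i, c i ∈ C i) ∧
      dist (toTorus x) (toTorus (∑ i, c i)) < δ := by
  by_contra! hfar
  have hε : 0 < δ / (2 * (n + 1)) := by positivity
  choose m p hp0 hpm hpC hpd using fun i => (hC i).exists_chain (ha i) (ha' i) hε
  let ψ : UnitAddTorus (Fin n) → ℝ := fun y => max 0 (δ / 2 - dist (toTorus x) y)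
  have hψ : Continuous ψ := by fun_prop
  have hpos : 0 < ∫ y, ψ y ∂(torusHaar (Fin n)) := by
    refine hψ.integral_pos_of_hasCompactSupport_nonneg_nonzero (x := toTorus x)
      (HasCompactSupport.of_compactSpace _) (fun y => le_max_left _ _) ?_
    simp only [ψ, dist_self, sub_zero]
    exact (lt_max_of_lt_right (by positivity)).ne'
  have key := integral_torus_eq_sum_polygonal m p (fun i => by rw [hpm, hp0])
    ⟨fun y => (ψ y : ℂ), by fun_prop⟩
  simp only [ContinuousMap.coe_mk] at key
  rw [integral_complex_ofReal, Finset.sum_eq_zero, Complex.ofReal_eq_zero] at key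
  · exact hpos.ne' key
  intro r _
  refine mul_eq_zero_of_right _ ?_
  rw [← Measure.restrict_pi_pi]
  refine setIntegral_eq_zero_of_forall_eq_zero fun t ht => ?_
  rw [Complex.ofReal_eq_zero]
  refine max_eq_left (sub_nonpos.2 ?_)
  have h1 := hfar (fun i => p i (r i)) fun i => hpC i _
  have h2 : dist (toTorus (∑ i, (p i (r i) + t i • (p i (r i + 1) - p i (r i)))))
      (toTorus (∑ i, p i (r i))) ≤ δ / 2 := by
    refine (dist_toTorus_le _ _).trans ?_
    rw [dist_eq_norm, ← Finset.sum_sub_distrib]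
    calc _ ≤ ∑ _i : Fin n, δ / (2 * (n + 1)) := by
          refine norm_sum_le_of_le _ fun i _ => ?_
          rw [add_sub_cancel_left, norm_smul, ← dist_eq_norm, dist_comm]
          have := ht i (mem_univ i)
          rw [Real.norm_of_nonneg this.1.le]
          exact (mul_le_of_le_one_left dist_nonneg this.2).trans (hpd i _).le
      _ ≤ δ / 2 := by
          simp only [Finset.sum_const, Finset.card_univ, Fintype.card_fin, nsmul_eq_mul]
          rw [mul_div_assoc', div_le_div_iff₀ (by positivity) (by positivity)]
          nlinarith
  have h3 := dist_triangle (toTorus x)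
    (toTorus (∑ i, (p i (r i) + t i • (p i (r i + 1) - p i (r i))))) (toTorus (∑ i, p i (r i)))
  linarith

/-- A compact set containing the sum of preconnected sets `C i`, each with two points differing by
the `i`-th basis vector, has nonempty interior. -/
lemma interior_nonempty_of_sum_subset_of_single {n : ℕ} (C : Fin n → Set (Fin n → ℝ))
    (hC : ∀ i, IsPreconnected (C i)) (a : Fin n → Fin n → ℝ) (ha : ∀ i, a i ∈ C i)
    (ha' : ∀ i, a i + Pi.single i 1 ∈ C i) {F : Set (Fin n → ℝ)} (hF : IsCompact F)
    (hCF : ∀ c : Fin n → Fin n → ℝ, (∀ i, c i ∈ C i) → ∑ i, c i ∈ F) :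
    (interior F).Nonempty := by
  have hmem (x : Fin n → ℝ) : toTorus x ∈ toTorus '' F := by
    have hcl : IsClosed (toTorus '' F) := (hF.image continuous_toTorus).isClosed
    rw [← hcl.closure_eq, Metric.mem_closure_iff]
    intro δ hδ
    obtain ⟨c, hc, hd⟩ := exists_dist_toTorus_sum_lt C hC a ha ha' x hδ
    exact ⟨_, mem_image_of_mem _ (hCF c hc), hd⟩
  have hcover : ⋃ z : Fin n → ℤ, (Homeomorph.addRight fun i => (z i : ℝ)) '' F = univ := by
    refine eq_univ_of_forall fun x => ?_
    obtain ⟨y, hy, hyx⟩ := hmem x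
    have : ∀ i, ∃ z : ℤ, y i + z = x i := by
      intro i
      have h := congrFun hyx i
      simp only [toTorus] at h
      rw [eq_comm, ← sub_eq_zero, ← AddCircle.coe_sub, AddCircle.coe_eq_zero_iff] at h
      obtain ⟨z, hz⟩ := h
      exact ⟨z, by rw [eq_sub_iff_add_eq] at hz; simpa [add_comm] using hz⟩
    choose z hz using this
    exact mem_iUnion.2 ⟨z, y, hy, funext hz⟩
  obtain ⟨z, hz⟩ := nonempty_interior_of_iUnion_of_closed
    (fun z : Fin n → ℤ => (Homeomorph.isClosed_image _).2 hF.isClosed) hcover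
  rw [← Homeomorph.image_interior] at hz
  exact hz.of_image

/-- A closed set containing the sum of bounded preconnected sets `C i`, which contain pairs of
points with linearly independent differences, has nonempty interior. -/
lemma interior_nonempty_of_sum_subset {n : ℕ} (C : Fin n → Set (Fin n → ℝ))
    (hC : ∀ i, IsPreconnected (C i)) (hb : ∀ i, Bornology.IsBounded (C i))
    (a b : Fin n → Fin n → ℝ) (ha : ∀ i, a i ∈ C i) (hb' : ∀ i, b i ∈ C i)
    (hab : LinearIndependent ℝ fun i => b i - a i) {F : Set (Fin n → ℝ)} (hF : IsClosed F)
    (hCF : ∀ c : Fin n → Fin n → ℝ, (∀ i, c i ∈ C i) → ∑ i, c i ∈ F) :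
    (interior F).Nonempty := by
  let B := basisOfLinearIndependentOfCardEqFinrank' _ hab (by simp)
  let T : (Fin n → ℝ) ≃L[ℝ] (Fin n → ℝ) := B.equivFun.toContinuousLinearEquiv
  have hT : ∀ i, T (b i - a i) = Pi.single i 1 := by
    intro i
    have : b i - a i = B i := by simp [B]
    rw [this]
    funext j
    simp [T, Pi.single_apply, eq_comm]
  let P : Set (Fin n → ℝ) := closure ((fun c : Fin n → Fin n → ℝ => ∑ i, c i) '' Set.pi univ C)
  have hP : IsCompact P := by
    refine IsCompact.closure_of_subset ((isCompact_univ_pi fun i => (hb i).isCompact_closure).image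
      (by fun_prop : Continuous fun c : Fin n → Fin n → ℝ => ∑ i, c i)) ?_
    exact image_mono (pi_mono fun i _ => subset_closure)
  have hPF : P ⊆ F := by
    refine closure_minimal ?_ hF
    rintro _ ⟨c, hc, rfl⟩
    exact hCF c fun i => hc i (mem_univ i)
  have := interior_nonempty_of_sum_subset_of_single (fun i => T '' C i)
    (fun i => (hC i).image _ T.continuous.continuousOn) (fun i => T (a i))
    (fun i => mem_image_of_mem _ (ha i))
    (fun i => ⟨b i, hb' i, by rw [← hT, map_sub, add_sub_cancel]⟩)
    (hP.image T.continuous) (fun c hc => by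
      choose d hd hdc using hc
      refine ⟨∑ i, d i, subset_closure ⟨d, fun i _ => hd i, rfl⟩, ?_⟩
      simp [hdc])
  rw [show (T '' P) = T.toHomeomorph '' P from rfl, ← Homeomorph.image_interior] at this
  exact this.of_image.mono (interior_mono hPF)

/-- Given `n` spanning sets in an `n`-dimensional space, one can pick one vector from each of them
to obtain a linearly independent family. -/
lemma exists_linearIndependent_of_span_eq_top {n : ℕ} {V : Type*} [AddCommGroup V] [Module ℝ V]
    (hn : Module.finrank ℝ V = n) (T : Fin n → Set V) (hT : ∀ i, Submodule.span ℝ (T i) = ⊤) :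
    ∃ v : Fin n → V, LinearIndependent ℝ v ∧ ∀ i, v i ∈ T i := by
  suffices h : ∀ k (hk : k ≤ n), ∃ v : Fin k → V, LinearIndependent ℝ v ∧
      ∀ i, v i ∈ T (Fin.castLE hk i) from h n le_rfl
  intro k
  induction k with
  | zero => exact fun _ => ⟨Fin.elim0, linearIndependent_empty_type, fun i => i.elim0⟩
  | succ k ih =>
    intro hk
    obtain ⟨v, hv, hvT⟩ := ih (Nat.le_of_succ_le hk)
    have : ¬ T (Fin.castLE hk (Fin.last k)) ⊆ Submodule.span ℝ (range v) := by
      intro hsub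
      have htop : Submodule.span ℝ (range v) = ⊤ :=
        top_le_iff.1 ((hT _).ge.trans (Submodule.span_le.2 hsub))
      have h1 := finrank_span_eq_card hv
      rw [htop, finrank_top, hn, Fintype.card_fin] at h1
      omega
    obtain ⟨t, ht, htv⟩ := not_subset.1 this
    refine ⟨Fin.snoc v t, linearIndependent_finSnoc.2 ⟨hv, htv⟩, fun i => ?_⟩
    refine Fin.lastCases ?_ (fun j => ?_) i
    · simpa using ht
    · simpa using hvT j

/-- The set of points at which `S` is locally non-meagre. -/
def nonMeagreAt {Y : Type*} [TopologicalSpace Y] (S : Set Y) : Set Y :=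
  {x | ∀ V, IsOpen V → x ∈ V → ¬ IsMeagre (V ∩ S)}

section BaireProperty

variable {Y : Type*} [TopologicalSpace Y]

lemma isClosed_nonMeagreAt (S : Set Y) : IsClosed (nonMeagreAt S) := by
  rw [← isOpen_compl_iff, isOpen_iff_forall_mem_open]
  intro x hx
  simp only [nonMeagreAt, mem_compl_iff, mem_ofPred_eq, not_forall, not_not] at hx
  obtain ⟨V, hV, hxV, hm⟩ := hx
  exact ⟨V, fun y hy hy' => hy' V hV hy hm, hV, hxV⟩

lemma nonMeagreAt_subset_closure (S : Set Y) : nonMeagreAt S ⊆ closure S := fun _ hx =>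
  mem_closure_iff.2 fun V hV hxV => nonempty_of_not_isMeagre (hx V hV hxV)

lemma isMeagre_diff_nonMeagreAt [SecondCountableTopology Y] (S : Set Y) :
    IsMeagre (S \ nonMeagreAt S) := by
  have hc : {V ∈ TopologicalSpace.countableBasis Y | IsMeagre (V ∩ S)}.Countable :=
    (TopologicalSpace.countable_countableBasis Y).mono (sep_subset _ _)
  refine IsMeagre.mono ?_ (isMeagre_biUnion hc (f := fun V => V ∩ S) fun V hV => hV.2)
  rintro x ⟨hxS, hx⟩
  simp only [nonMeagreAt, mem_ofPred_eq, not_forall, not_not] at hx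
  obtain ⟨V, hV, hxV, hm⟩ := hx
  obtain ⟨W, hW, hxW, hWV⟩ :=
    (TopologicalSpace.isBasis_countableBasis Y).exists_subset_of_mem_open hxV hV
  exact mem_biUnion (x := W) ⟨hW, hm.mono (inter_subset_inter_left _ hWV)⟩ ⟨hxW, hxS⟩

lemma isMeagre_nonMeagreAt_iUnion_diff [SecondCountableTopology Y] (S : ℕ → Set Y) :
    IsMeagre (nonMeagreAt (⋃ n, S n) \ ⋃ n, nonMeagreAt (S n)) := by
  refine IsMeagre.mono (s := nonMeagreAt (⋃ n, S n) \ ⋃ n, interior (nonMeagreAt (S n)))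
    (sdiff_subset_sdiff_right (iUnion_mono fun n => interior_subset)) (IsNowhereDense.isMeagre ?_)
  rw [IsClosed.isNowhereDense_iff
    ((isClosed_nonMeagreAt _).sdiff (isOpen_iUnion fun n => isOpen_interior))]
  by_contra! hne
  obtain ⟨x, hx⟩ := hne
  set V := interior (nonMeagreAt (⋃ n, S n) \ ⋃ n, interior (nonMeagreAt (S n))) with hV
  have hVo : IsOpen V := isOpen_interior
  have hVsub : V ⊆ nonMeagreAt (⋃ n, S n) \ ⋃ n, interior (nonMeagreAt (S n)) := interior_subset
  have h1 := (hVsub hx).1 V hVo hx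
  obtain ⟨k, hk⟩ : ∃ k, ¬ IsMeagre (V ∩ S k) := by
    by_contra! h
    exact h1 (by rw [inter_iUnion]; exact isMeagre_iUnion h)
  have h2 : ¬ IsNowhereDense (V ∩ nonMeagreAt (S k)) := fun h => hk <| by
    refine IsMeagre.mono ?_ (h.isMeagre.union (isMeagre_diff_nonMeagreAt (S k)))
    rintro y ⟨hyV, hyS⟩
    by_cases hy : y ∈ nonMeagreAt (S k)
    exacts [Or.inl ⟨hyV, hy⟩, Or.inr ⟨hyS, hy⟩]
  obtain ⟨y, hy⟩ := nonempty_iff_ne_empty.2 h2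
  obtain ⟨z, hz, hzV, -⟩ := mem_closure_iff.1 (interior_subset hy) _ isOpen_interior hy
  refine (hVsub hzV).2 (mem_iUnion.2 ⟨k, ?_⟩)
  exact interior_mono (closure_minimal inter_subset_right (isClosed_nonMeagreAt _)) hz

/-- A non-meagre continuous image of the Baire space is comeagre in some nonempty open set. -/
lemma exists_isOpen_isMeagre_diff_range [SecondCountableTopology Y] [T2Space Y]
    {f : (ℕ → ℕ) → Y} (hf : Continuous f) (hr : ¬ IsMeagre (range f)) :
    ∃ U : Set Y, IsOpen U ∧ U.Nonempty ∧ IsMeagre (U \ range f) := by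
  let N (l : List ℕ) : Set (ℕ → ℕ) := {y | PiNat.res y l.length = l}
  have hN0 : N [] = univ := by ext; simp [N]
  have hN (l : List ℕ) : f '' N l = ⋃ k, f '' N (k :: l) := by
    rw [← image_iUnion]
    congr 1
    ext y
    simp [N, PiNat.res_succ]
  let D (l : List ℕ) : Set Y := nonMeagreAt (f '' N l)
  refine ⟨interior (D []), isOpen_interior, ?_, ?_⟩
  · by_contra! h
    refine hr ?_
    rw [← (isClosed_nonMeagreAt _).isNowhereDense_iff] at h
    refine IsMeagre.mono ?_ (h.isMeagre.union (isMeagre_diff_nonMeagreAt (f '' N [])))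
    rw [union_sdiff_self, hN0, image_univ]
    exact subset_union_right
  · refine IsMeagre.mono ?_ (isMeagre_iUnion (f := fun l => D l \ ⋃ k, D (k :: l)) fun l => ?_)
    · rintro x ⟨hx, hxf⟩
      by_contra hx'
      have hstep : ∀ l, x ∈ D l → ∃ k, x ∈ D (k :: l) := by
        intro l hl
        by_contra hk
        exact hx' (mem_iUnion.2 ⟨l, hl, by simpa using hk⟩)
      have hstep' : ∀ l, ∃ k, x ∈ D l → x ∈ D (k :: l) := fun l => by
        by_cases h : x ∈ D l
        · exact (hstep l h).imp fun k hk _ => hk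
        · exact ⟨0, fun h' => absurd h' h⟩
      choose k hk using hstep'
      let L : ℕ → List ℕ := fun n => Nat.rec [] (fun _ l => k l :: l) n
      have hL : ∀ n, x ∈ D (L n) := by
        intro n
        induction n with
        | zero => exact interior_subset hx
        | succ n ih => exact hk _ ih
      let y : ℕ → ℕ := fun n => k (L n)
      have hy : ∀ n, PiNat.res y n = L n := by
        intro n
        induction n with
        | zero => rfl
        | succ n ih => rw [PiNat.res_succ, ih]
      refine hxf ⟨y, ?_⟩
      by_contra hne
      obtain ⟨U, V, hU, hV, hyU, hxV, hUV⟩ := t2_separation hne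
      obtain ⟨s, ⟨w, n, rfl⟩, hys, hsub⟩ :=
        (PiNat.isTopologicalBasis_cylinders fun _ : ℕ => ℕ).exists_subset_of_mem_open
          (show y ∈ f ⁻¹' U from hyU) (hU.preimage hf)
      obtain ⟨_, hzV, z, hz, rfl⟩ := mem_closure_iff.1 (nonMeagreAt_subset_closure _ (hL n)) V hV hxV
      refine disjoint_left.1 hUV (hsub ?_) hzV
      rw [← PiNat.mem_cylinder_iff_eq.1 hys, PiNat.cylinder_eq_res]
      have hlen : (L n).length = n := by rw [← hy n, PiNat.res_length]
      simp only [N, mem_ofPred_eq, hlen] at hz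
      simp [hz, hy]
    · simp only [D]
      rw [hN]
      exact isMeagre_nonMeagreAt_iUnion_diff _

end BaireProperty

/-- Piccard–Pettis: the difference set of a set that is comeagre in a nonempty open set is a
neighbourhood of zero. -/
lemma sub_mem_nhds_zero_of_isMeagre_diff {G : Type*} [AddCommGroup G] [TopologicalSpace G]
    [IsTopologicalAddGroup G] [BaireSpace G] {S U : Set G} (hU : IsOpen U) (hne : U.Nonempty)
    (hm : IsMeagre (U \ S)) : S - S ∈ 𝓝 (0 : G) := by
  obtain ⟨u, hu⟩ := hne
  have hc : Continuous fun x : G => u + x := by fun_prop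
  filter_upwards [(hU.preimage hc).mem_nhds (show (0 : G) ∈ _ by simpa using hu)] with x hx
  have hm' : IsMeagre ((fun y => y - x) ⁻¹' (U \ S)) :=
    hm.preimage_of_isOpenMap (by fun_prop) (Homeomorph.subRight x).isOpenMap
  have hW : IsOpen (U ∩ (fun y => y - x) ⁻¹' U) := hU.inter (hU.preimage (by fun_prop))
  have hWne : (U ∩ (fun y => y - x) ⁻¹' U).Nonempty := ⟨u + x, hx, by simpa using hu⟩
  have : ¬ (U ∩ (fun y => y - x) ⁻¹' U) ⊆ (U \ S) ∪ (fun y => y - x) ⁻¹' (U \ S) :=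
    fun h => not_isMeagre_of_isOpen hW hWne ((hm.union hm').mono h)
  obtain ⟨y, ⟨hyU, hyU'⟩, hy⟩ := not_subset.1 this
  simp only [mem_union, Set.mem_sdiff, mem_preimage, not_or, not_and, not_not] at hy
  exact ⟨y, hy.1 hyU, y - x, hy.2 hyU', by simp⟩

/-- A set whose trace on `closure K` is meagre has meagre trace on `K`. -/
lemma IsMeagre.of_preimage_closure {Y : Type*} [TopologicalSpace Y] {K A : Set Y}
    (h : IsMeagre (Subtype.val ⁻¹' A : Set (closure K))) : IsMeagre (Subtype.val ⁻¹' A : Set K) := by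
  rw [isMeagre_iff_countable_union_isNowhereDense] at h
  obtain ⟨S, hS, hSc, hsub⟩ := h
  let ι : K → closure K := inclusion subset_closure
  have hι : Continuous ι := continuous_inclusion _
  refine IsMeagre.mono ?_ (isMeagre_biUnion hSc (f := fun t => ι ⁻¹' closure t) fun t ht => ?_)
  · intro x hx
    obtain ⟨t, ht, hxt⟩ := hsub (show ι x ∈ _ from hx)
    exact mem_biUnion ht (subset_closure hxt)
  · refine IsNowhereDense.isMeagre ((isClosed_closure.preimage hι).isNowhereDense_iff.2 ?_)
    by_contra! hne
    obtain ⟨x, hx⟩ := hne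
    obtain ⟨V, hV, hVe⟩ := isOpen_induced_iff.1
      (isOpen_interior (s := ι ⁻¹' closure t))
    have hxV : x.1 ∈ V := by rw [← hVe] at hx; exact hx
    have hsub' : (Subtype.val ⁻¹' V : Set (closure K)) ⊆ closure t := by
      intro y hy
      by_contra hyt
      obtain ⟨O, hO, hOe⟩ := isOpen_induced_iff.1 (isClosed_closure (s := t)).isOpen_compl
      have hyO : y.1 ∈ O := by
        have : y ∈ (closure t)ᶜ := hyt
        rw [← hOe] at this; exact this
      obtain ⟨z, ⟨hzV, hzO⟩, hzK⟩ := mem_closure_iff.1 y.2 (V ∩ O) (hV.inter hO) ⟨hy, hyO⟩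
      have h1 : (⟨z, hzK⟩ : K) ∈ ι ⁻¹' closure t := by
        apply interior_subset
        rw [← hVe]
        exact hzV
      have h2 : ι ⟨z, hzK⟩ ∈ (closure t)ᶜ := by
        rw [← hOe]
        exact hzO
      exact h2 h1
    have h3 : ι x ∈ interior (closure t) :=
      interior_maximal hsub' (hV.preimage continuous_subtype_val) hxV
    rw [hS t ht] at h3
    exact h3

/-- In a locally connected nowhere flat set `K`, each nonempty relatively open set contains a
bounded preconnected set whose differences span the space. -/
lemma NowhereFlat.exists_isPreconnected {n : ℕ} {K : Set (Fin n → ℝ)} (hnf : NowhereFlat K)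
    (hloc : LocallyConnectedSpace K) {V : Set (Fin n → ℝ)} (hV : IsOpen V)
    (hVK : (V ∩ K).Nonempty) :
    ∃ C ⊆ V ∩ K, IsPreconnected C ∧ Bornology.IsBounded C ∧ Submodule.span ℝ (C - C) = ⊤ := by
  obtain ⟨x, hxV, hxK⟩ := hVK
  obtain ⟨W, hWsub, hWo, hxW, hWc⟩ := locallyConnectedSpace_iff_subsets_isOpen_isConnected.1 hloc
    ⟨x, hxK⟩ (Subtype.val ⁻¹' (V ∩ Metric.ball x 1))
    (((hV.inter Metric.isOpen_ball).preimage continuous_subtype_val).mem_nhds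
      ⟨hxV, Metric.mem_ball_self one_pos⟩)
  obtain ⟨O, hO, rfl⟩ := isOpen_induced_iff.1 hWo
  have himg : (Subtype.val '' (Subtype.val ⁻¹' O : Set K)) = O ∩ K := by
    rw [Subtype.image_preimage_coe, inter_comm]
  have hsub : O ∩ K ⊆ (V ∩ Metric.ball x 1) ∩ K :=
    fun y hy => ⟨hWsub (show (⟨y, hy.2⟩ : K) ∈ Subtype.val ⁻¹' O from hy.1), hy.2⟩
  refine ⟨O ∩ K, fun y hy => ⟨(hsub hy).1.1, hy.2⟩, ?_, ?_, ?_⟩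
  · rw [← himg]
    exact hWc.isPreconnected.image _ continuous_subtype_val.continuousOn
  · exact Metric.isBounded_ball.subset fun y hy => (hsub hy).1.2
  · have := congrArg AffineSubspace.direction (hnf O hO ⟨x, hxW, hxK⟩)
    rwa [direction_affineSpan, AffineSubspace.direction_top] at this

theorem nFoldSum_twice_interior_nonempty
    {n : ℕ} (hn : 0 < n) (K : Set (Fin n → ℝ))
    (hloc : LocallyConnectedSpace ↥K) (hnf : NowhereFlat K)
    (A : Set (Fin n → ℝ)) (hAK : A ⊆ K)
    (hanal : MeasureTheory.AnalyticSet A)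
    (hA : ¬ IsMeagre ((Subtype.val ⁻¹' A) : Set ↥K)) :
    nFoldSum (A - A) n ∈ nhds (0 : Fin n → ℝ) := by
  rw [AnalyticSet] at hanal
  obtain rfl | ⟨f, hf, rfl⟩ := hanal
  · exact absurd (by simpa using IsMeagre.empty) hA
  let X := closure K
  have : CompleteSpace X := isClosed_closure.isComplete.completeSpace_coe
  let g : (ℕ → ℕ) → X := fun y => ⟨f y, subset_closure (hAK ⟨y, rfl⟩)⟩
  have hg : Continuous g := hf.subtype_mk _
  have hgr : range g = Subtype.val ⁻¹' range f := by
    ext x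
    simp [g, Subtype.ext_iff]
  obtain ⟨U, hU, hUne, hUm⟩ := exists_isOpen_isMeagre_diff_range hg
    (by rw [hgr]; exact fun h => hA h.of_preimage_closure)
  let F : (Fin n → ℕ → ℕ) → Fin n → ℝ := fun y => ∑ i, f (y i)
  have hF : Continuous F := by fun_prop
  have hS : ¬ IsMeagre (range F) := by
    intro hm
    rw [isMeagre_iff_countable_union_isNowhereDense] at hm
    obtain ⟨S, hSn, hSc, hsub⟩ := hm
    let σ : (Fin n → X) → Fin n → ℝ := fun x => ∑ i, (x i).1
    have hσ : Continuous σ := by fun_prop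
    let P : Set (Fin n → X) := Set.pi univ fun _ => U
    have hPo : IsOpen P := isOpen_set_pi finite_univ fun _ _ => hU
    have hPne : P.Nonempty := univ_pi_nonempty_iff.2 fun _ => hUne
    refine not_isMeagre_of_isOpen hPo hPne (IsMeagre.mono ?_
      ((isMeagre_iUnion (f := fun i : Fin n => (fun x : Fin n → X => x i) ⁻¹' (U \ range g))
        fun i => hUm.preimage_of_isOpenMap (continuous_apply i) (isOpenMap_eval i)).union
        (isMeagre_biUnion hSc (f := fun t => σ ⁻¹' closure t) fun t ht => ?_)))
    · intro x hx
      by_cases h : ∀ i, x i ∈ range g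
      · right
        choose y hy using h
        have : σ x ∈ range F := ⟨y, by simp [F, σ, ← hy, g]⟩
        obtain ⟨t, ht, hxt⟩ := hsub this
        exact mem_biUnion ht (subset_closure hxt)
      · left
        push Not at h
        obtain ⟨i, hi⟩ := h
        exact mem_iUnion.2 ⟨i, hx i (mem_univ i), hi⟩
    · refine IsNowhereDense.isMeagre ((isClosed_closure.preimage hσ).isNowhereDense_iff.2 ?_)
      by_contra! hne
      obtain ⟨x, hx⟩ := hne
      obtain ⟨V, hV, hVsub⟩ := isOpen_pi_iff'.1 isOpen_interior x hx
      choose O hO hOe using fun i => isOpen_induced_iff.1 (hV i).1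
      have hOK : ∀ i, (O i ∩ K).Nonempty := fun i => by
        have : x i ∈ V i := (hV i).2
        rw [← hOe i] at this
        exact mem_closure_iff.1 (x i).2 (O i) (hO i) this
      choose C hCsub hCc hCb hCs using fun i => hnf.exists_isPreconnected hloc (hO i) (hOK i)
      obtain ⟨v, hv, hvC⟩ := exists_linearIndependent_of_span_eq_top (by simp)
        (fun i => C i - C i) hCs
      choose b hb a ha hab using hvC
      have hint := interior_nonempty_of_sum_subset C hCc hCb a b ha hb
        (by simpa only [hab] using hv) (isClosed_closure (s := t)) (fun c hc => by
          let c' : Fin n → X := fun i => ⟨c i, subset_closure (hCsub i (hc i)).2⟩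
          have : c' ∈ σ ⁻¹' closure t := interior_subset (hVsub fun i _ => by
            rw [← hOe i]
            exact (hCsub i (hc i)).1)
          exact this)
      rw [hSn t ht] at hint
      exact not_nonempty_empty hint
  have hFa := analyticSet_range_of_polishSpace hF
  rw [AnalyticSet] at hFa
  obtain hFe | ⟨φ, hφ, hφr⟩ := hFa
  · exact absurd (by rw [hFe]; exact IsMeagre.empty) hS
  obtain ⟨U', hU', hne', hm'⟩ := exists_isOpen_isMeagre_diff_range hφ (by rwa [hφr])
  rw [hφr] at hm'
  refine mem_of_superset (sub_mem_nhds_zero_of_isMeagre_diff hU' hne' hm') ?_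
  rintro _ ⟨_, ⟨y, rfl⟩, _, ⟨z, rfl⟩, rfl⟩
  exact ⟨fun i => f (y i) - f (z i), fun i => ⟨_, ⟨y i, rfl⟩, _, ⟨z i, rfl⟩, rfl⟩,
    by simp [F, Finset.sum_sub_distrib]⟩
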